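/- (r1: local codes to indices.) There is a primitive recursive function f : ℕ → ℕ such that if a ∈ C_rec then f(a) ∈ I_rec and ⟨f(a)⟩ = π(a) (i.e. ⟨f(a)⟩(x) = π(a)(x) for every x); in particular f(a) is an index of the recursive ω-proof π(a). -/

import Mathlib

namespace Shoen

/-- Kleene application: value of the `e`-th partial recursive function at `n`,
in the standard numbering via `Nat.Partrec.Code`. -/
def peval (e n : ℕ) : Part ℕ := (Denumerable.ofNat Nat.Partrec.Code e).eval n

/-- `e` is an index of a (total) primitive recursive function. -/
def PrimIndex (e : ℕ) : Prop := ∃ f : ℕ → ℕ, Nat.Primrec f ∧ ∀ n, peval e n = Part.some (f n)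

/-- Kleene's relation `<_O`. -/
inductive KLt : ℕ → ℕ → Prop
  | base : KLt 1 2
  | step {a b : ℕ} : KLt a b → KLt b (2 ^ b)
  | lim {e : ℕ} (h : ∀ n, (peval e n).Dom)
      (hm : ∀ n, KLt ((peval e n).get (h n)) ((peval e (n + 1)).get (h (n + 1))))
      (n : ℕ) : KLt ((peval e n).get (h n)) (3 * 5 ^ e)
  | trans {a b c : ℕ} : KLt a b → KLt b c → KLt a c

/-- Kleene's `O`. -/
def KO (a : ℕ) : Prop := KLt a (2 ^ a)

/-- The auxiliary relation `<'_O`. -/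
inductive KLt' : ℕ → ℕ → Prop
  | base : KLt' 1 2
  | step {a b : ℕ} : KLt' a b → KLt' b (2 ^ b)
  | lim {e n x : ℕ} : x ∈ peval e n → KLt' x (3 * 5 ^ e)
  | trans {a b c : ℕ} : KLt' a b → KLt' b c → KLt' a c

/-- The inductive characterization `O'` of Kleene's `O`. -/
inductive KO' : ℕ → Prop
  | one : KO' 1
  | step {a : ℕ} : KO' a → KO' (2 ^ a)
  | lim {e : ℕ} (h : ∀ n, (peval e n).Dom)
      (hm : ∀ n, KLt' ((peval e n).get (h n)) ((peval e (n + 1)).get (h (n + 1)))) :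
      KO' (3 * 5 ^ e)



/-! ### Syntax of first order arithmetic (negation normal form) -/

/-- Terms of the language `0,1,+,×,=`, with de Bruijn variables. -/
inductive Trm : Type
  | var : ℕ → Trm
  | zero : Trm
  | one : Trm
  | add : Trm → Trm → Trm
  | mul : Trm → Trm → Trm
deriving DecidableEq

/-- Formulas in negation normal form: literals (atomic and negated atomic
formulas) combined by `∧, ∨, ∀, ∃` (de Bruijn binders). -/
inductive Fml : Type
  | eq : Trm → Trm → Fml
  | ne : Trm → Trm → Fml
  | and : Fml → Fml → Fml
  | or : Fml → Fml → Fml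
  | all : Fml → Fml
  | ex : Fml → Fml
deriving DecidableEq

/-- All free variables of a term are `< k`. -/
def Trm.cu : Trm → ℕ → Bool
  | .var i, k => decide (i < k)
  | .zero, _ => true
  | .one, _ => true
  | .add s t, k => s.cu k && t.cu k
  | .mul s t, k => s.cu k && t.cu k

/-- All free variables of a formula are `< k`. -/
def Fml.cu : Fml → ℕ → Bool
  | .eq s t, k => s.cu k && t.cu k
  | .ne s t, k => s.cu k && t.cu k
  | .and A B, k => A.cu k && B.cu k
  | .or A B, k => A.cu k && B.cu k
  | .all A, k => A.cu (k + 1)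
  | .ex A, k => A.cu (k + 1)

/-- A sentence is a closed formula. -/
abbrev Sentence : Type := { A : Fml // A.cu 0 = true }

/-- Value of a term under an environment. -/
def Trm.val (ρ : ℕ → ℕ) : Trm → ℕ
  | .var i => ρ i
  | .zero => 0
  | .one => 1
  | .add s t => s.val ρ + t.val ρ
  | .mul s t => s.val ρ * t.val ρ

/-- Extend an environment by a value for variable `0`. -/
def consEnv (n : ℕ) (ρ : ℕ → ℕ) : ℕ → ℕ
  | 0 => n
  | k + 1 => ρ k

/-- Satisfaction in the standard model `ℕ`. -/
def Fml.Sat (ρ : ℕ → ℕ) : Fml → Prop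
  | .eq s t => s.val ρ = t.val ρ
  | .ne s t => s.val ρ ≠ t.val ρ
  | .and A B => A.Sat ρ ∧ B.Sat ρ
  | .or A B => A.Sat ρ ∨ B.Sat ρ
  | .all A => ∀ n : ℕ, A.Sat (consEnv n ρ)
  | .ex A => ∃ n : ℕ, A.Sat (consEnv n ρ)

/-- Truth of a sentence in the standard model. -/
def sentTrue (A : Sentence) : Prop := A.1.Sat (fun _ => 0)

/-- Substitution of a closed term `t` for variable `k` in a term. -/
def Trm.sub (t : Trm) (k : ℕ) : Trm → Trm
  | .var i => if i = k then t else if k < i then .var (i - 1) else .var i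
  | .zero => .zero
  | .one => .one
  | .add s u => .add (Trm.sub t k s) (Trm.sub t k u)
  | .mul s u => .mul (Trm.sub t k s) (Trm.sub t k u)

/-- Substitution of a closed term `t` for variable `k` in a formula. -/
def Fml.sub (t : Trm) : Fml → ℕ → Fml
  | .eq s u, k => .eq (Trm.sub t k s) (Trm.sub t k u)
  | .ne s u, k => .ne (Trm.sub t k s) (Trm.sub t k u)
  | .and A B, k => .and (A.sub t k) (B.sub t k)
  | .or A B, k => .or (A.sub t k) (B.sub t k)
  | .all A, k => .all (A.sub t (k + 1))
  | .ex A, k => .ex (A.sub t (k + 1))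

/-- The numeral `n̄`. -/
def numeral : ℕ → Trm
  | 0 => .zero
  | n + 1 => .add (numeral n) .one

theorem Trm.cu_mono : ∀ (t : Trm) {j k : ℕ}, j ≤ k → t.cu j = true → t.cu k = true := by
  intro t
  induction t with
  | var i =>
    intro j k h ht
    simp only [Trm.cu, decide_eq_true_eq] at *
    omega
  | zero => intros; rfl
  | one => intros; rfl
  | add s u ihs ihu =>
    intro j k h ht
    simp only [Trm.cu, Bool.and_eq_true] at *
    exact ⟨ihs h ht.1, ihu h ht.2⟩
  | mul s u ihs ihu =>
    intro j k h ht
    simp only [Trm.cu, Bool.and_eq_true] at *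
    exact ⟨ihs h ht.1, ihu h ht.2⟩

theorem Trm.cu_sub : ∀ (s : Trm) {k : ℕ} {t : Trm},
    t.cu 0 = true → s.cu (k + 1) = true → (Trm.sub t k s).cu k = true := by
  intro s
  induction s with
  | var i =>
    intro k t ht hs
    simp only [Trm.cu, decide_eq_true_eq] at hs
    simp only [Trm.sub]
    by_cases h : i = k
    · rw [if_pos h]
      exact Trm.cu_mono t (Nat.zero_le k) ht
    · have h2 : ¬ k < i := by omega
      rw [if_neg h, if_neg h2]
      simp only [Trm.cu, decide_eq_true_eq]
      omega
  | zero => intros; rfl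
  | one => intros; rfl
  | add s u ihs ihu =>
    intro k t ht hs
    simp only [Trm.cu, Bool.and_eq_true] at hs
    simp only [Trm.sub, Trm.cu, Bool.and_eq_true]
    exact ⟨ihs ht hs.1, ihu ht hs.2⟩
  | mul s u ihs ihu =>
    intro k t ht hs
    simp only [Trm.cu, Bool.and_eq_true] at hs
    simp only [Trm.sub, Trm.cu, Bool.and_eq_true]
    exact ⟨ihs ht hs.1, ihu ht hs.2⟩

theorem Fml.cu_sub : ∀ (A : Fml) {k : ℕ} {t : Trm},
    t.cu 0 = true → A.cu (k + 1) = true → (A.sub t k).cu k = true := by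
  intro A
  induction A with
  | eq s u =>
    intro k t ht hA
    simp only [Fml.cu, Bool.and_eq_true] at hA
    simp only [Fml.sub, Fml.cu, Bool.and_eq_true]
    exact ⟨Trm.cu_sub s ht hA.1, Trm.cu_sub u ht hA.2⟩
  | ne s u =>
    intro k t ht hA
    simp only [Fml.cu, Bool.and_eq_true] at hA
    simp only [Fml.sub, Fml.cu, Bool.and_eq_true]
    exact ⟨Trm.cu_sub s ht hA.1, Trm.cu_sub u ht hA.2⟩
  | and A B ihA ihB =>
    intro k t ht h
    simp only [Fml.cu, Bool.and_eq_true] at h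
    simp only [Fml.sub, Fml.cu, Bool.and_eq_true]
    exact ⟨ihA ht h.1, ihB ht h.2⟩
  | or A B ihA ihB =>
    intro k t ht h
    simp only [Fml.cu, Bool.and_eq_true] at h
    simp only [Fml.sub, Fml.cu, Bool.and_eq_true]
    exact ⟨ihA ht h.1, ihB ht h.2⟩
  | all A ihA =>
    intro k t ht h
    simp only [Fml.cu] at h
    simp only [Fml.sub, Fml.cu]
    exact ihA ht h
  | ex A ihA =>
    intro k t ht h
    simp only [Fml.cu] at h
    simp only [Fml.sub, Fml.cu]
    exact ihA ht h

theorem numeral_cu : ∀ n : ℕ, (numeral n).cu 0 = true := by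
  intro n
  induction n with
  | zero => rfl
  | succ n ih => simp [numeral, Trm.cu, ih]

/-- Negation (de Morgan dual) of a formula in negation normal form. -/
def Fml.neg : Fml → Fml
  | .eq s t => .ne s t
  | .ne s t => .eq s t
  | .and A B => .or A.neg B.neg
  | .or A B => .and A.neg B.neg
  | .all A => .ex A.neg
  | .ex A => .all A.neg

theorem Fml.cu_neg : ∀ (A : Fml) {k : ℕ}, A.cu k = true → A.neg.cu k = true := by
  intro A
  induction A with
  | eq s u => intro k h; simpa [Fml.cu, Fml.neg] using h
  | ne s u => intro k h; simpa [Fml.cu, Fml.neg] using h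
  | and A B ihA ihB =>
    intro k h
    simp only [Fml.cu, Bool.and_eq_true] at h
    simp only [Fml.neg, Fml.cu, Bool.and_eq_true]
    exact ⟨ihA h.1, ihB h.2⟩
  | or A B ihA ihB =>
    intro k h
    simp only [Fml.cu, Bool.and_eq_true] at h
    simp only [Fml.neg, Fml.cu, Bool.and_eq_true]
    exact ⟨ihA h.1, ihB h.2⟩
  | all A ihA =>
    intro k h
    simp only [Fml.cu] at h
    simp only [Fml.neg, Fml.cu]
    exact ihA h
  | ex A ihA =>
    intro k h
    simp only [Fml.cu] at h
    simp only [Fml.neg, Fml.cu]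
    exact ihA h

/-- Conjunction of sentences. -/
def sAnd (A B : Sentence) : Sentence :=
  ⟨.and A.1 B.1, by simp [Fml.cu, A.2, B.2]⟩

/-- Disjunction of sentences. -/
def sOr (A B : Sentence) : Sentence :=
  ⟨.or A.1 B.1, by simp [Fml.cu, A.2, B.2]⟩

/-- Negation of a sentence. -/
def sNeg (A : Sentence) : Sentence := ⟨A.1.neg, Fml.cu_neg A.1 A.2⟩

/-- The sentence `∀x A(x)`, for `A` with (at most) one free variable. -/
def sAll (A : Fml) (h : A.cu 1 = true) : Sentence := ⟨.all A, by simpa [Fml.cu] using h⟩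

/-- The sentence `∃x A(x)`, for `A` with (at most) one free variable. -/
def sEx (A : Fml) (h : A.cu 1 = true) : Sentence := ⟨.ex A, by simpa [Fml.cu] using h⟩

/-- The instance `A(n̄)` of a formula `A` with one free variable. -/
def sInst (A : Fml) (h : A.cu 1 = true) (n : ℕ) : Sentence :=
  ⟨A.sub (numeral n) 0, Fml.cu_sub A (numeral_cu n) h⟩

/-- Literals: atomic and negated atomic formulas. -/
def Fml.isLiteral : Fml → Bool
  | .eq _ _ => true
  | .ne _ _ => true
  | _ => false

/-- Quantifier free formulas. -/
def Fml.qf : Fml → Bool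
  | .eq _ _ => true
  | .ne _ _ => true
  | .and A B => A.qf && B.qf
  | .or A B => A.qf && B.qf
  | .all _ => false
  | .ex _ => false

/-- An axiom is a sequent containing a true closed literal. -/
def IsAxiom (Γ : Finset Sentence) : Prop :=
  ∃ A ∈ Γ, A.1.isLiteral = true ∧ sentTrue A

/-- A sequent is true if some member is true. -/
def SeqTrue (Γ : Finset Sentence) : Prop := ∃ A ∈ Γ, sentTrue A


/-! ### A primitive recursive Gödel numbering of terms, sentences and sequents -/

/-- Gödel number of a term. -/
def Trm.enc : Trm → ℕ
  | .var i => 5 * i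
  | .zero => 1
  | .one => 2
  | .add s t => 5 * Nat.pair s.enc t.enc + 3
  | .mul s t => 5 * Nat.pair s.enc t.enc + 4

/-- Fuelled decoding of terms. -/
def Trm.dec : ℕ → ℕ → Option Trm
  | 0, _ => none
  | fuel + 1, n =>
    if n % 5 = 0 then some (.var (n / 5))
    else if n % 5 = 1 then some .zero
    else if n % 5 = 2 then some .one
    else if n % 5 = 3 then
      match Trm.dec fuel (n / 5).unpair.1, Trm.dec fuel (n / 5).unpair.2 with
      | some s, some t => some (.add s t)
      | _, _ => none
    else
      match Trm.dec fuel (n / 5).unpair.1, Trm.dec fuel (n / 5).unpair.2 with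
      | some s, some t => some (.mul s t)
      | _, _ => none

theorem Trm.dec_enc : ∀ (t : Trm) (fuel : ℕ), t.enc < fuel → Trm.dec fuel t.enc = some t := by
  intro t
  induction t with
  | var i =>
    intro fuel h
    match fuel with
    | f + 1 =>
      have h0 : (5 * i) % 5 = 0 := by omega
      have h1 : (5 * i) / 5 = i := by omega
      simp [Trm.dec, Trm.enc, h0, h1]
  | zero =>
    intro fuel h
    match fuel with
    | f + 1 => simp [Trm.dec, Trm.enc]
  | one =>
    intro fuel h
    match fuel with
    | f + 1 => simp [Trm.dec, Trm.enc]
  | add s u ihs ihu =>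
    intro fuel h
    match fuel with
    | f + 1 =>
      simp only [Trm.enc] at h ⊢
      set p := Nat.pair s.enc u.enc with hp
      have h0 : (5 * p + 3) % 5 = 3 := by omega
      have h1 : (5 * p + 3) / 5 = p := by omega
      have hs : s.enc < f := by
        have := Nat.left_le_pair s.enc u.enc
        omega
      have hu : u.enc < f := by
        have := Nat.right_le_pair s.enc u.enc
        omega
      simp only [Trm.dec, h0, h1]
      rw [hp, Nat.unpair_pair, ihs f hs, ihu f hu]
      simp
  | mul s u ihs ihu =>
    intro fuel h
    match fuel with
    | f + 1 =>
      simp only [Trm.enc] at h ⊢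
      set p := Nat.pair s.enc u.enc with hp
      have h0 : (5 * p + 4) % 5 = 4 := by omega
      have h1 : (5 * p + 4) / 5 = p := by omega
      have hs : s.enc < f := by
        have := Nat.left_le_pair s.enc u.enc
        omega
      have hu : u.enc < f := by
        have := Nat.right_le_pair s.enc u.enc
        omega
      simp only [Trm.dec, h0, h1]
      rw [hp, Nat.unpair_pair, ihs f hs, ihu f hu]
      simp

instance : Encodable Trm :=
  ⟨Trm.enc, fun n => Trm.dec (n + 1) n, fun t => Trm.dec_enc t _ (Nat.lt_succ_self _)⟩

/-- Gödel number of a formula. -/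
def Fml.enc : Fml → ℕ
  | .eq s t => 6 * Nat.pair s.enc t.enc
  | .ne s t => 6 * Nat.pair s.enc t.enc + 1
  | .and A B => 6 * Nat.pair A.enc B.enc + 2
  | .or A B => 6 * Nat.pair A.enc B.enc + 3
  | .all A => 6 * A.enc + 4
  | .ex A => 6 * A.enc + 5

/-- Fuelled decoding of formulas. -/
def Fml.dec : ℕ → ℕ → Option Fml
  | 0, _ => none
  | fuel + 1, n =>
    if n % 6 = 0 then
      match Encodable.decode (α := Trm) (n / 6).unpair.1,
            Encodable.decode (α := Trm) (n / 6).unpair.2 with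
      | some s, some t => some (.eq s t)
      | _, _ => none
    else if n % 6 = 1 then
      match Encodable.decode (α := Trm) (n / 6).unpair.1,
            Encodable.decode (α := Trm) (n / 6).unpair.2 with
      | some s, some t => some (.ne s t)
      | _, _ => none
    else if n % 6 = 2 then
      match Fml.dec fuel (n / 6).unpair.1, Fml.dec fuel (n / 6).unpair.2 with
      | some A, some B => some (.and A B)
      | _, _ => none
    else if n % 6 = 3 then
      match Fml.dec fuel (n / 6).unpair.1, Fml.dec fuel (n / 6).unpair.2 with
      | some A, some B => some (.or A B)
      | _, _ => none
    else if n % 6 = 4 then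
      match Fml.dec fuel (n / 6) with
      | some A => some (.all A)
      | none => none
    else
      match Fml.dec fuel (n / 6) with
      | some A => some (.ex A)
      | none => none

theorem Fml.dec_enc : ∀ (A : Fml) (fuel : ℕ), A.enc < fuel → Fml.dec fuel A.enc = some A := by
  intro A
  induction A with
  | eq s u =>
    intro fuel h
    match fuel with
    | f + 1 =>
      simp only [Fml.enc] at h ⊢
      set p := Nat.pair s.enc u.enc with hp
      have h0 : (6 * p) % 6 = 0 := by omega
      have h1 : (6 * p) / 6 = p := by omega
      have hds : Encodable.decode (α := Trm) s.enc = some s := Encodable.encodek s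
      have hdu : Encodable.decode (α := Trm) u.enc = some u := Encodable.encodek u
      simp only [Fml.dec, h0, h1]
      rw [hp, Nat.unpair_pair, hds, hdu]
      simp
  | ne s u =>
    intro fuel h
    match fuel with
    | f + 1 =>
      simp only [Fml.enc] at h ⊢
      set p := Nat.pair s.enc u.enc with hp
      have h0 : (6 * p + 1) % 6 = 1 := by omega
      have h1 : (6 * p + 1) / 6 = p := by omega
      have hds : Encodable.decode (α := Trm) s.enc = some s := Encodable.encodek s
      have hdu : Encodable.decode (α := Trm) u.enc = some u := Encodable.encodek u
      simp only [Fml.dec, h0, h1]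
      rw [hp, Nat.unpair_pair, hds, hdu]
      simp
  | and A B ihA ihB =>
    intro fuel h
    match fuel with
    | f + 1 =>
      simp only [Fml.enc] at h ⊢
      set p := Nat.pair A.enc B.enc with hp
      have h0 : (6 * p + 2) % 6 = 2 := by omega
      have h1 : (6 * p + 2) / 6 = p := by omega
      have hA : A.enc < f := by
        have := Nat.left_le_pair A.enc B.enc
        omega
      have hB : B.enc < f := by
        have := Nat.right_le_pair A.enc B.enc
        omega
      simp only [Fml.dec, h0, h1]
      rw [hp, Nat.unpair_pair, ihA f hA, ihB f hB]
      simp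
  | or A B ihA ihB =>
    intro fuel h
    match fuel with
    | f + 1 =>
      simp only [Fml.enc] at h ⊢
      set p := Nat.pair A.enc B.enc with hp
      have h0 : (6 * p + 3) % 6 = 3 := by omega
      have h1 : (6 * p + 3) / 6 = p := by omega
      have hA : A.enc < f := by
        have := Nat.left_le_pair A.enc B.enc
        omega
      have hB : B.enc < f := by
        have := Nat.right_le_pair A.enc B.enc
        omega
      simp only [Fml.dec, h0, h1]
      rw [hp, Nat.unpair_pair, ihA f hA, ihB f hB]
      simp
  | all A ihA =>
    intro fuel h
    match fuel with
    | f + 1 =>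
      simp only [Fml.enc] at h ⊢
      have h0 : (6 * A.enc + 4) % 6 = 4 := by omega
      have h1 : (6 * A.enc + 4) / 6 = A.enc := by omega
      have hA : A.enc < f := by omega
      simp [Fml.dec, h0, h1, ihA f hA]
  | ex A ihA =>
    intro fuel h
    match fuel with
    | f + 1 =>
      simp only [Fml.enc] at h ⊢
      have h0 : (6 * A.enc + 5) % 6 = 5 := by omega
      have h1 : (6 * A.enc + 5) / 6 = A.enc := by omega
      have hA : A.enc < f := by omega
      simp [Fml.dec, h0, h1, ihA f hA]

instance : Encodable Fml :=
  ⟨Fml.enc, fun n => Fml.dec (n + 1) n, fun A => Fml.dec_enc A _ (Nat.lt_succ_self _)⟩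

/-- Gödel number of a sentence. -/
def encF (A : Sentence) : ℕ := Encodable.encode A

/-- Gödel number of a sequent (finite set of sentences). -/
def encS (Γ : Finset Sentence) : ℕ := Encodable.encode Γ

/-- Decode a Gödel number into a sentence (with a default value). -/
def decF (n : ℕ) : Sentence := (Encodable.decode (α := Sentence) n).getD ⟨.eq .zero .zero, rfl⟩

/-- Decode a Gödel number into a sequent (with a default value). -/
def decS (n : ℕ) : Finset Sentence := (Encodable.decode (α := Finset Sentence) n).getD ∅

/-! ### Tupling of natural numbers, with projections -/

/-- Code of a finite sequence (tuple) of natural numbers; codes are nonzero. -/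
def tup (l : List ℕ) : ℕ := Encodable.encode l + 1

/-- The finite sequence coded by a natural number. -/
def untup (a : ℕ) : List ℕ := Denumerable.ofNat (List ℕ) (a - 1)

/-- The `i`-th projection `(a)_i`. -/
def proj (a i : ℕ) : ℕ := (untup a).getD i 0

/-- `a` codes a finite sequence (every nonzero number does, bijectively). -/
def InSeq (a : ℕ) : Prop := a ≠ 0

/-- The code of the empty sequence `⟨⟩` (the root). -/
def rootSeq : ℕ := tup []

/-- The code of `σ⌢i`. -/
def snoc (σ i : ℕ) : ℕ := tup (untup σ ++ [i])

/-! ### Names for the inference rules -/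

def axC : ℕ := 1
def andC : ℕ := 2
def orC : ℕ := 3
def omC : ℕ := 4
def exC : ℕ := 5
def cutC : ℕ := 6
def omrepC : ℕ := 7

/-- The end sequent of a (code of a) proof or proof node: `(a)_1` if the rule
`(a)_0` carries no main formula, and `(a)_1 ∪ {(a)_2}` otherwise. -/
def EndS (a : ℕ) : Finset Sentence :=
  if proj a 0 = cutC ∨ proj a 0 = axC ∨ proj a 0 = omrepC then decS (proj a 1)
  else decS (proj a 1) ∪ {decF (proj a 2)}

/-! ### Local codes of ω-proofs -/

/-- Local codes of `ω`-proofs, in Tait style.  The three `Bool` parameters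
respectively allow the cut rule, restrict the `ω`-rule to indices of primitive
recursive functions, and allow the vacuous `ω`-repetition rule. -/
inductive CGen (c p r : Bool) : ℕ → Prop
  | ax (Γ : Finset Sentence) (h : IsAxiom Γ) : CGen c p r (tup [axC, encS Γ])
  | and {a b : ℕ} (Γ : Finset Sentence) (A B : Sentence)
      (ha : CGen c p r a) (hb : CGen c p r b)
      (ea : EndS a = Γ ∪ {A}) (eb : EndS b = Γ ∪ {B}) :
      CGen c p r (tup [andC, encS Γ, encF (sAnd A B), a, b])
  | or {a : ℕ} (Γ : Finset Sentence) (A B : Sentence) (ha : CGen c p r a)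
      (ea : EndS a = Γ ∪ {A, B}) :
      CGen c p r (tup [orC, encS Γ, encF (sOr A B), a])
  | om {e : ℕ} (Γ : Finset Sentence) (A : Fml) (hA : A.cu 1 = true)
      (hp : p = true → PrimIndex e)
      (htot : ∀ n, (peval e n).Dom)
      (hmem : ∀ n, CGen c p r ((peval e n).get (htot n)))
      (hend : ∀ n, EndS ((peval e n).get (htot n)) = Γ ∪ {sInst A hA n}) :
      CGen c p r (tup [omC, encS Γ, encF (sAll A hA), e])
  | ex {a : ℕ} (Γ : Finset Sentence) (A : Fml) (hA : A.cu 1 = true) (n : ℕ)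
      (ha : CGen c p r a) (ea : EndS a = Γ ∪ {sInst A hA n}) :
      CGen c p r (tup [exC, encS Γ, encF (sEx A hA), a])
  | cut {a b : ℕ} (hc : c = true) (Γ : Finset Sentence) (C : Sentence)
      (ha : CGen c p r a) (hb : CGen c p r b)
      (ea : EndS a = Γ ∪ {C}) (eb : EndS b = Γ ∪ {sNeg C}) :
      CGen c p r (tup [cutC, encS Γ, encF C, a, b])
  | omrep {e : ℕ} (hr : r = true) (Γ : Finset Sentence) (hp : PrimIndex e)
      (htot : ∀ n, (peval e n).Dom)
      (hmem : ∀ n, CGen c p r ((peval e n).get (htot n)))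
      (hend : ∀ n, EndS ((peval e n).get (htot n)) = Γ) :
      CGen c p r (tup [omrepC, encS Γ, e])

/-- `C_rec`: recursive local codes of `ω`-proofs. -/
def Crec : ℕ → Prop := CGen true false false

/-- `C_rec^-`: the cut free fragment of `C_rec`. -/
def CrecM : ℕ → Prop := CGen false false false

/-- `C_prec`: primitive recursive local codes of `ω`-proofs. -/
def Cprec : ℕ → Prop := CGen true true false

/-- `C_prec^-`: the cut free fragment of `C_prec`. -/
def CprecM : ℕ → Prop := CGen false true false

/-- `C_prec^{ω-rep}`: `C_prec` with the vacuous `ω`-repetition rule. -/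
def CprecRep : ℕ → Prop := CGen true true true

/-! ### ω-proofs as well founded trees of sequents -/

/-- `σ` is a node of the tree `T_π = {σ ∈ Seq : π(σ) ∈ Seq}`. -/
def TreeOf (π : ℕ → ℕ) (σ : ℕ) : Prop := σ ≠ 0 ∧ π σ ≠ 0

/-- The tree `T_π` is well founded: it has no infinite branch. -/
def WFTree (π : ℕ → ℕ) : Prop :=
  ¬ ∃ f : ℕ → ℕ, ∀ n : ℕ, TreeOf π (tup ((List.range n).map f))

/-- The inference at an inner node of an `ω`-proof is a correct instance of one
of the rules of Tait-style `ω`-arithmetic. -/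
def CorrectInner (π : ℕ → ℕ) (σ : ℕ) : Prop :=
  (∃ (Γ : Finset Sentence) (A B : Sentence),
    π σ = tup [andC, encS Γ, encF (sAnd A B)] ∧
    TreeOf π (snoc σ 0) ∧ TreeOf π (snoc σ 1) ∧ ¬ TreeOf π (snoc σ 2) ∧
    EndS (π (snoc σ 0)) = Γ ∪ {A} ∧ EndS (π (snoc σ 1)) = Γ ∪ {B}) ∨
  (∃ (Γ : Finset Sentence) (A B : Sentence),
    π σ = tup [orC, encS Γ, encF (sOr A B)] ∧
    TreeOf π (snoc σ 0) ∧ ¬ TreeOf π (snoc σ 1) ∧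
    EndS (π (snoc σ 0)) = Γ ∪ {A, B}) ∨
  (∃ (Γ : Finset Sentence) (A : Fml) (hA : A.cu 1 = true),
    π σ = tup [omC, encS Γ, encF (sAll A hA)] ∧
    (∀ n : ℕ, TreeOf π (snoc σ n)) ∧
    (∀ n : ℕ, EndS (π (snoc σ n)) = Γ ∪ {sInst A hA n})) ∨
  (∃ (Γ : Finset Sentence) (A : Fml) (hA : A.cu 1 = true) (n : ℕ),
    π σ = tup [exC, encS Γ, encF (sEx A hA)] ∧
    TreeOf π (snoc σ 0) ∧ ¬ TreeOf π (snoc σ 1) ∧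
    EndS (π (snoc σ 0)) = Γ ∪ {sInst A hA n}) ∨
  (∃ (Γ : Finset Sentence) (C : Sentence),
    π σ = tup [cutC, encS Γ, encF C] ∧
    TreeOf π (snoc σ 0) ∧ TreeOf π (snoc σ 1) ∧ ¬ TreeOf π (snoc σ 2) ∧
    EndS (π (snoc σ 0)) = Γ ∪ {C} ∧ EndS (π (snoc σ 1)) = Γ ∪ {sNeg C})

/-- Local correctness of a function `π : ℕ → ℕ` viewed as a tree of sequents:
all conditions in the definition of `ω`-proof except well-foundedness. -/
structure LocallyCorrect (π : ℕ → ℕ) : Prop where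
  /-- values outside `Seq` are `0` -/
  nonseq : ∀ σ, ¬ InSeq (π σ) → π σ = 0
  /-- `T_π` is closed under initial segments -/
  downward : ∀ σ τ, TreeOf π σ → τ ≠ 0 → untup τ <+: untup σ → TreeOf π τ
  /-- children come first -/
  mono : ∀ σ i j, i < j → TreeOf π (snoc σ j) → TreeOf π (snoc σ i)
  /-- top nodes are axioms -/
  top : ∀ σ, TreeOf π σ → ¬ TreeOf π (snoc σ 0) →
    ∃ Γ : Finset Sentence, IsAxiom Γ ∧ π σ = tup [axC, encS Γ]
  /-- inner nodes are correct inferences -/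
  inner : ∀ σ, TreeOf π σ → TreeOf π (snoc σ 0) → CorrectInner π σ

/-- `π : ℕ → ℕ` is an `ω`-proof. -/
structure IsOmegaProof (π : ℕ → ℕ) extends LocallyCorrect π : Prop where
  /-- the tree `T_π` is well founded -/
  wf : WFTree π

/-- An `ω`-proof is cut free if no node is labelled `cut`. -/
def CutFree (π : ℕ → ℕ) : Prop := ∀ σ, TreeOf π σ → proj (π σ) 0 ≠ cutC

/-! ### The ω-proof `π(a)` coded by a local code `a` -/

open Classical in
/-- The code of the subproof at child `n` of the proof coded by `a`. -/
noncomputable def childCode (a n : ℕ) : ℕ :=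
  if proj a 0 = omC then
    (if h : (peval (proj a 3) n).Dom then (peval (proj a 3) n).get h else 0)
  else if proj a 0 = andC ∨ proj a 0 = orC ∨ proj a 0 = exC ∨ proj a 0 = cutC then
    proj a (n + 3)
  else 0

/-- Walk down a local code along a path. -/
noncomputable def walkCode (a : ℕ) : List ℕ → ℕ
  | [] => a
  | i :: l => walkCode (childCode a i) l

/-- The node label `⟨R,Γ,A⟩` (or `⟨Ax,Γ⟩`) determined by a local code. -/
def nodeVal (b : ℕ) : ℕ :=
  if proj b 0 = axC then tup [axC, proj b 1]
  else if proj b 0 = andC ∨ proj b 0 = orC ∨ proj b 0 = omC ∨ proj b 0 = exC ∨ proj b 0 = cutC then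
    tup [proj b 0, proj b 1, proj b 2]
  else 0

/-- The `ω`-proof `π(a)` determined by a local code `a` (with value `0` at all
other arguments). -/
noncomputable def piOf (a : ℕ) (σ : ℕ) : ℕ :=
  if σ = 0 then 0 else nodeVal (walkCode a (untup σ))

/-! ### Indices (global codes) of recursive and primitive recursive ω-proofs -/

/-- `I_rec`: `a` is an index of a recursive `ω`-proof. -/
def Irec (a : ℕ) : Prop :=
  ∃ h : ∀ n, (peval a n).Dom, IsOmegaProof (fun n => (peval a n).get (h n))

/-- `I_prec`: `a` is an index of a primitive recursive `ω`-proof. -/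
def Iprec (a : ℕ) : Prop :=
  ∃ f : ℕ → ℕ, Nat.Primrec f ∧ (∀ n, peval a n = Part.some (f n)) ∧ IsOmegaProof f

/-- `I_prec^-`: `a` is an index of a primitive recursive cut free `ω`-proof. -/
def IprecM (a : ℕ) : Prop :=
  ∃ f : ℕ → ℕ, Nat.Primrec f ∧ (∀ n, peval a n = Part.some (f n)) ∧
    IsOmegaProof f ∧ CutFree f

/-! ### Ordinal lengths -/

open Classical in
/-- `x + 1` if `P` holds, and `0` otherwise. -/
noncomputable def succIf (P : Prop) (x : Ordinal.{0}) : Ordinal.{0} :=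
  if P then x + 1 else 0

/-- The ordinal rank of a node of the tree `T_π`:
`rank σ = sup {rank (σ⌢i) + 1 : σ⌢i ∈ T_π}`. -/
inductive NodeRank (π : ℕ → ℕ) : ℕ → Ordinal.{0} → Prop
  | mk (σ : ℕ) (o : ℕ → Ordinal.{0})
      (h : ∀ i, TreeOf π (snoc σ i) → NodeRank π (snoc σ i) (o i)) :
      NodeRank π σ (⨆ i, succIf (TreeOf π (snoc σ i)) (o i))

/-- The ordinal length of a local code:  `|⟨Ax,Γ⟩| = 0`,
`|⟨R,Γ,A,a₁,…,a_k⟩| = sup{|a₁|,…,|a_k|} + 1`, and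
`|⟨ω,Γ,∀xA(x),e⟩| = sup{|⟨e⟩(n)| + 1 : n ∈ ℕ}`. -/
inductive CLen : ℕ → Ordinal.{0} → Prop
  | ax (g : ℕ) : CLen (tup [axC, g]) 0
  | one (R g x a : ℕ) (o : Ordinal.{0}) (hR : R = orC ∨ R = exC) (h : CLen a o) :
      CLen (tup [R, g, x, a]) (o + 1)
  | two (R g x a b : ℕ) (oa ob : Ordinal.{0}) (hR : R = andC ∨ R = cutC)
      (ha : CLen a oa) (hb : CLen b ob) :
      CLen (tup [R, g, x, a, b]) ((oa ⊔ ob) + 1)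
  | om (g x e : ℕ) (h : ∀ n, (peval e n).Dom) (o : ℕ → Ordinal.{0})
      (ho : ∀ n, CLen ((peval e n).get (h n)) (o n)) :
      CLen (tup [omC, g, x, e]) (⨆ n, o n + 1)

/-- The ordinal `|a|` of a notation `a ∈ O`:  `|1| = 0`, `|2^a| = |a| + 1`,
`|3·5^e| = sup{|⟨e⟩(n)| : n ∈ ℕ}`. -/
inductive KOrd : ℕ → Ordinal.{0} → Prop
  | one : KOrd 1 0
  | step {a : ℕ} {o : Ordinal.{0}} : KOrd a o → KOrd (2 ^ a) (o + 1)
  | lim {e : ℕ} (h : ∀ n, (peval e n).Dom) (o : ℕ → Ordinal.{0})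
      (ho : ∀ n, KOrd ((peval e n).get (h n)) (o n)) :
      KOrd (3 * 5 ^ e) (⨆ n, o n)


open Classical in
/-- One step of the sequence `a(f)` determined by a local code. -/
noncomputable def branchStep (b k : ℕ) : Option ℕ :=
  if (∃ (Γ : Finset Sentence) (A B : Sentence) (b₀ b₁ : ℕ),
        b = tup [andC, encS Γ, encF (sAnd A B), b₀, b₁]) ∨
     (∃ (Γ : Finset Sentence) (C : Sentence) (b₀ b₁ : ℕ),
        b = tup [cutC, encS Γ, encF C, b₀, b₁]) then
    some (proj b (3 + k % 2))
  else if ∃ (Γ : Finset Sentence) (A B : Sentence) (c : ℕ),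
      b = tup [orC, encS Γ, encF (sOr A B), c] then
    some (proj b 3)
  else if ∃ (Γ : Finset Sentence) (A : Fml) (hA : A.cu 1 = true) (e : ℕ),
      b = tup [omC, encS Γ, encF (sAll A hA), e] then
    (if h : (peval (proj b 3) k).Dom then some ((peval (proj b 3) k).get h) else none)
  else none

/-- The sequence `a(f) = ⟨a₀,a₁,…⟩`:  `chain a f i = some aᵢ` if the `i`-th
element of the sequence is defined, and `none` otherwise. -/
noncomputable def chain (a : ℕ) (f : ℕ → ℕ) : ℕ → Option ℕ
  | 0 => some a
  | i + 1 =>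
    match chain a f i with
    | none => none
    | some b => branchStep b (f i)

/-! ### Tupling -/

theorem untup_tup (l : List ℕ) : untup (tup l) = l := by
  simp [untup, tup]

theorem tup_ne_zero (l : List ℕ) : tup l ≠ 0 := Nat.succ_ne_zero _

theorem proj_tup (l : List ℕ) (i : ℕ) : proj (tup l) i = l.getD i 0 := by
  rw [proj, untup_tup]

theorem untup_zero : untup 0 = [] := by
  simp [untup]

theorem proj_zero (i : ℕ) : proj 0 i = 0 := by
  simp [proj, untup_zero]

theorem snoc_ne_zero (σ i : ℕ) : snoc σ i ≠ 0 := tup_ne_zero _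

theorem primrec_untup : Primrec untup :=
  (Primrec.ofNat (List ℕ)).comp (Primrec.nat_sub.comp Primrec.id (Primrec.const 1))

theorem primrec_tup : Primrec tup := Primrec.succ.comp Primrec.encode

theorem primrec_proj : Primrec₂ proj :=
  (Primrec.list_getD 0).comp (primrec_untup.comp Primrec.fst) Primrec.snd

/-! ### Walking down a local code -/

theorem childCode_zero (n : ℕ) : childCode 0 n = 0 := by
  simp [childCode, proj_zero, omC]

theorem nodeVal_zero : nodeVal 0 = 0 := by
  simp [nodeVal, proj_zero, axC, andC, orC, omC, exC, cutC]

theorem walkCode_concat (a : ℕ) (l : List ℕ) (i : ℕ) :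
    walkCode a (l ++ [i]) = childCode (walkCode a l) i := by
  induction l generalizing a with
  | nil => rfl
  | cons j l ih => exact ih _

theorem walkCode_zero (l : List ℕ) : walkCode 0 l = 0 := by
  induction l with
  | nil => rfl
  | cons j l ih => rw [walkCode, childCode_zero, ih]

theorem walkCode_append (a : ℕ) (l m : List ℕ) :
    walkCode a (l ++ m) = walkCode (walkCode a l) m := by
  induction l generalizing a with
  | nil => rfl
  | cons j l ih => exact ih _

theorem childCode_om {g x e : ℕ} (h : ∀ n, (peval e n).Dom) (n : ℕ) :
    childCode (tup [omC, g, x, e]) n = (peval e n).get (h n) := by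
  simp [childCode, proj_tup, h n]

theorem childCode_ax (g n : ℕ) : childCode (tup [axC, g]) n = 0 := by
  simp [childCode, proj_tup, axC, omC, andC, orC, exC, cutC]

theorem childCode_finitary {R : ℕ} (hR : R = andC ∨ R = orC ∨ R = exC ∨ R = cutC)
    (g x n : ℕ) (l : List ℕ) :
    childCode (tup (R :: g :: x :: l)) n = l.getD n 0 := by
  have : R ≠ omC := by
    rcases hR with rfl | rfl | rfl | rfl <;> decide
  simp [childCode, proj_tup, this, hR]

theorem nodeVal_inner {R : ℕ} (hR : R = andC ∨ R = orC ∨ R = omC ∨ R = exC ∨ R = cutC)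
    (g x : ℕ) (l : List ℕ) :
    nodeVal (tup (R :: g :: x :: l)) = tup [R, g, x] := by
  have : R ≠ axC := by
    rcases hR with rfl | rfl | rfl | rfl | rfl <;> decide
  simp [nodeVal, proj_tup, this, hR]

theorem nodeVal_ax (g : ℕ) : nodeVal (tup [axC, g]) = tup [axC, g] := by
  simp [nodeVal, proj_tup]

theorem Crec.ne_zero {a : ℕ} (h : Crec a) : a ≠ 0 := by
  cases h <;> exact tup_ne_zero _

theorem not_crec_zero : ¬ Crec 0 := fun h => h.ne_zero rfl

theorem Crec.nodeVal_ne_zero {a : ℕ} (h : Crec a) : nodeVal a ≠ 0 := by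
  cases h with
  | ax => rw [nodeVal_ax]; exact tup_ne_zero _
  | omrep hr => cases hr
  | _ => rw [nodeVal_inner (by simp)]; exact tup_ne_zero _

theorem Crec.endS_nodeVal {a : ℕ} (h : Crec a) : EndS (nodeVal a) = EndS a := by
  cases h with
  | ax => rw [nodeVal_ax]
  | omrep hr => cases hr
  | _ => rw [nodeVal_inner (by simp)]; simp [EndS, proj_tup]

/-- Induction on local codes along the passage to immediate subproofs. -/
theorem Crec.induction_child {P : ℕ → Prop}
    (H : ∀ a, Crec a → (∀ n, Crec (childCode a n) → P (childCode a n)) → P a)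
    {a : ℕ} (h : Crec a) : P a := by
  have step : ∀ {a : ℕ}, Crec a → (∀ n, childCode a n = 0 ∨ P (childCode a n)) → P a := by
    intro a ha hc
    refine H a ha fun n hn => (hc n).resolve_left hn.ne_zero
  induction h with
  | ax Γ h => exact step (.ax Γ h) fun n => .inl (childCode_ax _ n)
  | and Γ A B ha hb ea eb iha ihb =>
    refine step (.and Γ A B ha hb ea eb) fun n => ?_
    rw [childCode_finitary (by simp)]
    match n with
    | 0 => exact .inr iha
    | 1 => exact .inr ihb
    | n + 2 => exact .inl rfl
  | or Γ A B ha ea iha =>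
    refine step (.or Γ A B ha ea) fun n => ?_
    rw [childCode_finitary (by simp)]
    match n with
    | 0 => exact .inr iha
    | n + 1 => exact .inl rfl
  | om Γ A hA hp htot hmem hend ih =>
    refine step (.om Γ A hA hp htot hmem hend) fun n => ?_
    rw [childCode_om htot]
    exact .inr (ih n)
  | ex Γ A hA n ha ea iha =>
    refine step (.ex Γ A hA n ha ea) fun n => ?_
    rw [childCode_finitary (by simp)]
    match n with
    | 0 => exact .inr iha
    | n + 1 => exact .inl rfl
  | cut hc Γ C ha hb ea eb iha ihb =>
    refine step (.cut hc Γ C ha hb ea eb) fun n => ?_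
    rw [childCode_finitary (by simp)]
    match n with
    | 0 => exact .inr iha
    | 1 => exact .inr ihb
    | n + 2 => exact .inl rfl
  | omrep hr => cases hr

theorem Crec.childCode {a : ℕ} (h : Crec a) (n : ℕ) :
    Crec (childCode a n) ∨ Shoen.childCode a n = 0 := by
  cases h with
  | ax => exact .inr (childCode_ax _ n)
  | om Γ A hA hp htot hmem hend =>
    rw [childCode_om htot]
    exact .inl (hmem n)
  | omrep hr => cases hr
  | and Γ A B ha hb =>
    rw [childCode_finitary (by simp)]
    match n with
    | 0 => exact .inl ha
    | 1 => exact .inl hb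
    | n + 2 => exact .inr rfl
  | cut hc Γ C ha hb =>
    rw [childCode_finitary (by simp)]
    match n with
    | 0 => exact .inl ha
    | 1 => exact .inl hb
    | n + 2 => exact .inr rfl
  | or Γ A B ha =>
    rw [childCode_finitary (by simp)]
    match n with
    | 0 => exact .inl ha
    | n + 1 => exact .inr rfl
  | ex Γ A hA m ha =>
    rw [childCode_finitary (by simp)]
    match n with
    | 0 => exact .inl ha
    | n + 1 => exact .inr rfl

theorem Crec.childCode_mono {a i j : ℕ} (h : Crec a) (hij : i < j)
    (hj : Crec (Shoen.childCode a j)) : Crec (Shoen.childCode a i) := by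
  cases h with
  | ax => rw [childCode_ax] at hj; exact absurd hj not_crec_zero
  | om Γ A hA hp htot hmem hend =>
    rw [childCode_om htot]
    exact hmem i
  | omrep hr => cases hr
  | and Γ A B ha hb =>
    rw [childCode_finitary (by simp)] at hj ⊢
    match i, j, hij with
    | 0, _, _ => exact ha
    | 1, _, _ => exact hb
    | i + 2, j + 2, _ => exact absurd hj not_crec_zero
  | cut hc Γ C ha hb =>
    rw [childCode_finitary (by simp)] at hj ⊢
    match i, j, hij with
    | 0, _, _ => exact ha
    | 1, _, _ => exact hb
    | i + 2, j + 2, _ => exact absurd hj not_crec_zero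
  | or Γ A B ha =>
    rw [childCode_finitary (by simp)] at hj ⊢
    match i, j, hij with
    | 0, _, _ => exact ha
    | i + 1, j + 1, _ => exact absurd hj not_crec_zero
  | ex Γ A hA m ha =>
    rw [childCode_finitary (by simp)] at hj ⊢
    match i, j, hij with
    | 0, _, _ => exact ha
    | i + 1, j + 1, _ => exact absurd hj not_crec_zero

theorem Crec.walkCode {a : ℕ} (h : Crec a) (l : List ℕ) :
    Crec (walkCode a l) ∨ Shoen.walkCode a l = 0 := by
  induction l generalizing a with
  | nil => exact .inl h
  | cons i l ih =>
    rcases h.childCode i with hc | hc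
    · exact ih hc
    · rw [Shoen.walkCode, hc]
      exact .inr (walkCode_zero l)

/-! ### `π(a)` is an `ω`-proof -/

theorem Crec.nodeVal_walkCode_ne_zero {a : ℕ} (h : Crec a) (l : List ℕ) :
    nodeVal (Shoen.walkCode a l) ≠ 0 ↔ Crec (Shoen.walkCode a l) := by
  refine ⟨fun hn => (h.walkCode l).resolve_right fun h0 => hn ?_, fun hc => hc.nodeVal_ne_zero⟩
  rw [h0, nodeVal_zero]

theorem Crec.treeOf_piOf {a : ℕ} (h : Crec a) {σ : ℕ} (hσ : σ ≠ 0) :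
    TreeOf (piOf a) σ ↔ Crec (Shoen.walkCode a (untup σ)) := by
  rw [TreeOf, piOf, if_neg hσ, h.nodeVal_walkCode_ne_zero]
  exact and_iff_right hσ

theorem piOf_snoc (a σ i : ℕ) :
    piOf a (snoc σ i) = nodeVal (childCode (walkCode a (untup σ)) i) := by
  rw [piOf, if_neg (snoc_ne_zero σ i), snoc, untup_tup, walkCode_concat]

theorem Crec.treeOf_piOf_snoc {a : ℕ} (h : Crec a) (σ i : ℕ) :
    TreeOf (piOf a) (snoc σ i) ↔ Crec (Shoen.childCode (Shoen.walkCode a (untup σ)) i) := by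
  rw [h.treeOf_piOf (snoc_ne_zero σ i), snoc, untup_tup, walkCode_concat]

theorem Crec.top {b : ℕ} (h : Crec b) (h0 : ¬ Crec (Shoen.childCode b 0)) :
    ∃ Γ : Finset Sentence, IsAxiom Γ ∧ nodeVal b = tup [axC, encS Γ] := by
  cases h with
  | ax Γ h => exact ⟨Γ, h, nodeVal_ax _⟩
  | om Γ A hA hp htot hmem hend =>
    rw [childCode_om htot] at h0
    exact absurd (hmem 0) h0
  | omrep hr => cases hr
  | and Γ A B ha => rw [childCode_finitary (by simp)] at h0; exact absurd ha h0
  | cut hc Γ C ha => rw [childCode_finitary (by simp)] at h0; exact absurd ha h0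
  | or Γ A B ha => rw [childCode_finitary (by simp)] at h0; exact absurd ha h0
  | ex Γ A hA m ha => rw [childCode_finitary (by simp)] at h0; exact absurd ha h0

theorem Crec.correctInner {a : ℕ} (h : Crec a) {σ : ℕ} (hσ : TreeOf (piOf a) σ)
    (h0 : TreeOf (piOf a) (snoc σ 0)) : CorrectInner (piOf a) σ := by
  have hval : piOf a σ = nodeVal (Shoen.walkCode a (untup σ)) := if_neg hσ.1
  rw [h.treeOf_piOf hσ.1] at hσ
  rw [h.treeOf_piOf_snoc] at h0
  unfold CorrectInner
  simp only [h.treeOf_piOf_snoc, piOf_snoc, hval]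
  generalize Shoen.walkCode a (untup σ) = b at hσ h0
  cases hσ with
  | ax => rw [childCode_ax] at h0; exact absurd h0 not_crec_zero
  | omrep hr => cases hr
  | and Γ A B ha hb ea eb =>
    refine .inl ⟨Γ, A, B, nodeVal_inner (by simp) _ _ _, ?_⟩
    simp only [childCode_finitary (R := andC) (by simp)]
    exact ⟨ha, hb, not_crec_zero, (Crec.endS_nodeVal ha).trans ea,
      (Crec.endS_nodeVal hb).trans eb⟩
  | or Γ A B ha ea =>
    refine .inr (.inl ⟨Γ, A, B, nodeVal_inner (by simp) _ _ _, ?_⟩)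
    simp only [childCode_finitary (R := orC) (by simp)]
    exact ⟨ha, not_crec_zero, (Crec.endS_nodeVal ha).trans ea⟩
  | om Γ A hA hp htot hmem hend =>
    refine .inr (.inr (.inl ⟨Γ, A, hA, nodeVal_inner (by simp) _ _ _, ?_⟩))
    simp only [childCode_om htot]
    exact ⟨hmem, fun n => (Crec.endS_nodeVal (hmem n)).trans (hend n)⟩
  | ex Γ A hA n ha ea =>
    refine .inr (.inr (.inr (.inl ⟨Γ, A, hA, n, nodeVal_inner (by simp) _ _ _, ?_⟩)))
    simp only [childCode_finitary (R := exC) (by simp)]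
    exact ⟨ha, not_crec_zero, (Crec.endS_nodeVal ha).trans ea⟩
  | cut hc Γ C ha hb ea eb =>
    refine .inr (.inr (.inr (.inr ⟨Γ, C, nodeVal_inner (by simp) _ _ _, ?_⟩)))
    simp only [childCode_finitary (R := cutC) (by simp)]
    exact ⟨ha, hb, not_crec_zero, (Crec.endS_nodeVal ha).trans ea,
      (Crec.endS_nodeVal hb).trans eb⟩

/-- No infinite path stays inside `C_rec`. -/
theorem Crec.not_forall_walkCode {a : ℕ} (h : Crec a) (f : ℕ → ℕ) :
    ¬ ∀ n, Crec (Shoen.walkCode a ((List.range n).map f)) := by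
  revert f
  refine Crec.induction_child
    (P := fun a => ∀ f : ℕ → ℕ, ¬ ∀ n, Crec (Shoen.walkCode a ((List.range n).map f)))
    (fun a _ ih f hf => ?_) h
  refine ih (f 0) (hf 1) (fun n => f (n + 1)) fun n => ?_
  have := hf (n + 1)
  rwa [List.range_succ_eq_map, List.map_cons, List.map_map] at this

theorem Crec.isOmegaProof_piOf {a : ℕ} (h : Crec a) : IsOmegaProof (piOf a) where
  nonseq σ hσ := not_not.mp hσ
  downward σ τ hσ hτ hpre := by
    rw [h.treeOf_piOf hσ.1] at hσ
    rw [h.treeOf_piOf hτ]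
    obtain ⟨l, hl⟩ := hpre
    rw [← hl, walkCode_append] at hσ
    refine (h.walkCode _).resolve_right fun h0 => ?_
    rw [h0, walkCode_zero] at hσ
    exact not_crec_zero hσ
  mono σ i j hij hj := by
    rw [h.treeOf_piOf_snoc] at hj ⊢
    rcases h.walkCode (untup σ) with hc | hc
    · exact hc.childCode_mono hij hj
    · rw [hc, childCode_zero] at hj
      exact absurd hj not_crec_zero
  top σ hσ h0 := by
    rw [h.treeOf_piOf_snoc] at h0
    have hval : piOf a σ = nodeVal (Shoen.walkCode a (untup σ)) := if_neg hσ.1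
    rw [hval]
    exact ((h.treeOf_piOf hσ.1).1 hσ).top h0
  inner σ hσ h0 := h.correctInner hσ h0
  wf := by
    rintro ⟨f, hf⟩
    refine h.not_forall_walkCode f fun n => ?_
    simpa only [h.treeOf_piOf (tup_ne_zero _), untup_tup] using hf n

/-! ### Computability of `π(a)`, uniformly in `a` -/

/-- Partial recursive version of `childCode`. -/
def childPart (a n : ℕ) : Part ℕ :=
  bif decide (proj a 0 = omC) then peval (proj a 3) n
  else Part.some
    (if proj a 0 = andC ∨ proj a 0 = orC ∨ proj a 0 = exC ∨ proj a 0 = cutC then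
      proj a (n + 3) else 0)

theorem partrec₂_peval : Partrec₂ peval :=
  Nat.Partrec.Code.eval_part.comp
    ((Computable.ofNat Nat.Partrec.Code).comp Computable.fst) Computable.snd

theorem primrecPred_proj_eq {α : Type*} [Primcodable α] {f : α → ℕ} (hf : Primrec f) (i c : ℕ) :
    PrimrecPred fun x => proj (f x) i = c :=
  Primrec.eq.comp (primrec_proj.comp hf (Primrec.const i)) (Primrec.const c)

theorem partrec₂_childPart : Partrec₂ childPart := by
  have hp (c : ℕ) := primrecPred_proj_eq (α := ℕ × ℕ) Primrec.fst 0 c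
  refine Partrec.cond (hp omC).decide.to_comp ?_ ?_
  · exact partrec₂_peval.comp
      (primrec_proj.comp Primrec.fst (Primrec.const 3)).to_comp Computable.snd
  · refine Computable.partrec (Primrec.to_comp ?_)
    exact Primrec.ite ((hp andC).or ((hp orC).or ((hp exC).or (hp cutC))))
      (primrec_proj.comp Primrec.fst
        (Primrec.nat_add.comp Primrec.snd (Primrec.const 3)))
      (Primrec.const 0)

theorem childPart_zero (n : ℕ) : childPart 0 n = Part.some 0 := by
  simp [childPart, proj_zero, omC]

theorem Crec.childPart_eq {a : ℕ} (h : Crec a) (n : ℕ) :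
    childPart a n = Part.some (Shoen.childCode a n) := by
  by_cases hom : proj a 0 = omC
  · cases h with
    | om Γ A hA hp htot hmem hend =>
      rw [childCode_om htot]
      simp [childPart, proj_tup, Part.some_get]
    | omrep hr => cases hr
    | _ => simp [proj_tup, axC, andC, orC, omC, exC, cutC] at hom
  · simp [childPart, Shoen.childCode, hom]

theorem primrec_nodeVal : Primrec nodeVal := by
  have hp (c : ℕ) := primrecPred_proj_eq Primrec.id 0 c
  have hq (i : ℕ) : Primrec fun b => proj b i := primrec_proj.comp Primrec.id (Primrec.const i)
  refine Primrec.ite (hp axC) (primrec_tup.comp ?_) (Primrec.ite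
    ((hp andC).or ((hp orC).or ((hp omC).or ((hp exC).or (hp cutC)))))
    (primrec_tup.comp ?_) (Primrec.const 0))
  · exact Primrec.list_cons.comp (Primrec.const _)
      (Primrec.list_cons.comp (hq 1) (Primrec.const []))
  · exact Primrec.list_cons.comp (hq 0) (Primrec.list_cons.comp (hq 1)
      (Primrec.list_cons.comp (hq 2) (Primrec.const [])))

/-- Partial recursive version of walking along the first `k` entries of the path `σ`. -/
def walkPart (a σ k : ℕ) : Part ℕ :=
  Nat.rec (Part.some a) (fun j b => b.bind fun c => childPart c ((untup σ).getD j 0)) k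

theorem Crec.walkPart_eq {a : ℕ} (h : Crec a) (σ k : ℕ) (hk : k ≤ (untup σ).length) :
    walkPart a σ k = Part.some (Shoen.walkCode a ((untup σ).take k)) := by
  induction k with
  | zero => rfl
  | succ k ih =>
    have hstep : walkPart a σ (k + 1) =
      (walkPart a σ k).bind fun c => childPart c ((untup σ).getD k 0) := rfl
    rw [hstep, ih (by omega), Part.bind_some, List.take_succ_eq_append_getElem (by omega),
      walkCode_concat, List.getD_eq_getElem _ _ (by omega)]
    rcases h.walkCode ((untup σ).take k) with hc | hc
    · exact hc.childPart_eq _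
    · rw [hc, childPart_zero, childCode_zero]

/-- Partial recursive version of `piOf`. -/
def piPart (a σ : ℕ) : Part ℕ :=
  (walkPart a σ (untup σ).length).map fun b => if σ = 0 then 0 else nodeVal b

theorem Crec.piPart_eq {a : ℕ} (h : Crec a) (σ : ℕ) : piPart a σ = Part.some (piOf a σ) := by
  rw [piPart, h.walkPart_eq σ _ le_rfl, List.take_length, Part.map_some, piOf]

theorem partrec₂_piPart : Partrec₂ piPart := by
  have hstep : Partrec₂ fun (p : ℕ × ℕ) (q : ℕ × ℕ) =>
      childPart q.2 ((untup p.2).getD q.1 0) :=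
    partrec₂_childPart.comp (Computable.snd.comp Computable.snd)
      ((Primrec.list_getD 0).comp
        (primrec_untup.comp (Primrec.snd.comp Primrec.fst))
        (Primrec.fst.comp Primrec.snd)).to_comp
  have hwalk : Partrec fun p : ℕ × ℕ => walkPart p.1 p.2 (untup p.2).length :=
    Partrec.nat_rec (Primrec.list_length.comp (primrec_untup.comp Primrec.snd)).to_comp
      Computable.fst.partrec hstep
  refine hwalk.map (Primrec.to_comp ?_)
  exact Primrec.ite (Primrec.eq.comp (Primrec.snd.comp Primrec.fst) (Primrec.const 0))
    (Primrec.const 0) (primrec_nodeVal.comp Primrec.snd)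

/-- **(r1): local codes to indices.**  There is a primitive recursive `f` such
that if `a ∈ C_rec` then `f(a) ∈ I_rec` is an index of the `ω`-proof `π(a)`,
i.e. `⟨f(a)⟩ = π(a)`. -/
theorem code_to_index :
    ∃ f : ℕ → ℕ, Nat.Primrec f ∧
      ∀ a : ℕ, Crec a →
        Irec (f a) ∧ ∀ x : ℕ, peval (f a) x = Part.some (piOf a x) := by
  obtain ⟨c, hc⟩ := Nat.Partrec.Code.exists_code.1
    (Partrec.nat_iff.1 (partrec₂_piPart.comp
      (Primrec.fst.comp Primrec.unpair).to_comp (Primrec.snd.comp Primrec.unpair).to_comp))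
  refine ⟨fun a => Encodable.encode (c.curry a), Primrec.nat_iff.1 (Primrec.encode.comp
    (Nat.Partrec.Code.primrec₂_curry.comp (Primrec.const c) Primrec.id)), fun a ha => ?_⟩
  have heval (x : ℕ) :
      peval (Encodable.encode (c.curry a)) x = Part.some (piOf a x) := by
    rw [peval, Denumerable.ofNat_encode, Nat.Partrec.Code.eval_curry, hc]
    simpa using ha.piPart_eq x
  refine ⟨⟨fun n => ?_, ?_⟩, heval⟩
  · rw [heval]
    trivial
  · simpa only [heval, Part.get_some] using ha.isOmegaProof_piOf

end Shoen
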